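/- Let d ≥ 1 and let σ be the surface measure on the unit sphere S^{d−1} ⊂ ℝ^d and λ Lebesgue measure on (0,∞). For s ∈ ℝ^d let A_s = {(φ, r) ∈ S^{d−1} × (0,∞) : 0 < r < ⟨φ, s⟩}. Then for all s, t ∈ ℝ^d, the measure of the symmetric difference satisfies (σ ⊗ λ)(A_s Δ A_t) = (1/2) ∫_{S^{d−1}} |⟨φ, s − t⟩| σ(dφ) = C‖s − t‖, where C = (1/2) ∫_{S^{d−1}} |⟨φ, e_1⟩| σ(dφ) and e_1 is any fixed unit vector. -/

import Mathlib

open MeasureTheory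
open scoped RealInnerProductSpace

/-- The set of (parameters of) hyperplanes separating the origin from `s`:
`A_s = {(φ,r) : 0 < r < ⟨φ,s⟩}` in `S^{d−1} × (0,∞)` (Example 3.2, Lévy–Chentsov). -/
def chentsovSet (d : ℕ) (s : EuclideanSpace ℝ (Fin d)) :
    Set (Metric.sphere (0 : EuclideanSpace ℝ (Fin d)) 1 × ℝ) :=
  {p | 0 < p.2 ∧ p.2 < ⟪(p.1 : EuclideanSpace ℝ (Fin d)), s⟫}

open Metric Set
open scoped Pointwise

section SphereIsometry

variable {E : Type*} [NormedAddCommGroup E] [InnerProductSpace ℝ E]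

/-- The action of a linear isometric equivalence on the unit sphere. -/
def LinearIsometryEquiv.onUnitSphere (L : E ≃ₗᵢ[ℝ] E) (φ : sphere (0 : E) 1) : sphere (0 : E) 1 :=
  ⟨L φ, by simp⟩

@[simp]
theorem LinearIsometryEquiv.coe_onUnitSphere (L : E ≃ₗᵢ[ℝ] E) (φ : sphere (0 : E) 1) :
    (L.onUnitSphere φ : E) = L φ := rfl

theorem LinearIsometryEquiv.continuous_onUnitSphere (L : E ≃ₗᵢ[ℝ] E) :
    Continuous L.onUnitSphere :=
  (L.continuous.comp continuous_subtype_val).subtype_mk _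

variable [FiniteDimensional ℝ E] [MeasurableSpace E] [BorelSpace E]

/-- The surface measure is invariant under linear isometries. -/
theorem LinearIsometryEquiv.measurePreserving_onUnitSphere (L : E ≃ₗᵢ[ℝ] E) :
    MeasurePreserving L.onUnitSphere (volume : Measure E).toSphere
      (volume : Measure E).toSphere := by
  refine ⟨L.continuous_onUnitSphere.measurable, Measure.ext fun S hS => ?_⟩
  have hpre := L.continuous_onUnitSphere.measurable hS
  have hcone : Ioo (0 : ℝ) 1 • ((↑) '' (L.onUnitSphere ⁻¹' S) : Set E) =
      L ⁻¹' (Ioo (0 : ℝ) 1 • ((↑) '' S : Set E)) := by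
    ext x
    simp only [Set.mem_smul, mem_preimage, mem_image]
    constructor
    · rintro ⟨c, hc, _, ⟨φ, hφ, rfl⟩, rfl⟩
      exact ⟨c, hc, _, ⟨_, hφ, rfl⟩, by simp⟩
    · rintro ⟨c, hc, _, ⟨φ, hφ, rfl⟩, h⟩
      have hψ : L.onUnitSphere (L.symm.onUnitSphere φ) = φ := by ext; simp
      refine ⟨c, hc, _, ⟨L.symm.onUnitSphere φ, by rwa [hψ], rfl⟩, L.injective ?_⟩
      simpa using h
  rw [Measure.map_apply L.continuous_onUnitSphere.measurable hS, Measure.toSphere_apply' _ hpre,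
    Measure.toSphere_apply' _ hS, hcone,
    L.measurePreserving.measure_preimage_emb L.toHomeomorph.measurableEmbedding]

theorem Continuous.integrable_toSphere {f : sphere (0 : E) 1 → ℝ} (hf : Continuous f) :
    Integrable f (volume : Measure E).toSphere :=
  hf.integrable_of_hasCompactSupport (HasCompactSupport.of_compactSpace f)

theorem integral_toSphere_comp_isometry (L : E ≃ₗᵢ[ℝ] E) {f : sphere (0 : E) 1 → ℝ}
    (hf : Continuous f) :
    ∫ φ, f (L.onUnitSphere φ) ∂(volume : Measure E).toSphere =
      ∫ φ, f φ ∂(volume : Measure E).toSphere := by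
  have h := L.measurePreserving_onUnitSphere
  conv_rhs => rw [← h.map_eq]
  exact (integral_map h.measurable.aemeasurable hf.aestronglyMeasurable).symm

/-- The integral of `|⟪φ, x⟫|` over the unit sphere depends only on the norm of `x`. -/
theorem integral_toSphere_abs_inner_eq_of_norm_eq {x y : E} (h : ‖x‖ = ‖y‖) :
    ∫ φ : sphere (0 : E) 1, |⟪(φ : E), x⟫| ∂(volume : Measure E).toSphere =
      ∫ φ : sphere (0 : E) 1, |⟪(φ : E), y⟫| ∂(volume : Measure E).toSphere := by
  set L : E ≃ₗᵢ[ℝ] E := (Submodule.span ℝ {x - y})ᗮ.reflection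
  have hL : L x = y := Submodule.reflection_sub h
  rw [← integral_toSphere_comp_isometry L (f := fun φ => |⟪(φ : E), y⟫|) (by fun_prop)]
  simp [← hL]

theorem integral_toSphere_abs_inner (x e : E) (he : ‖e‖ = 1) :
    ∫ φ : sphere (0 : E) 1, |⟪(φ : E), x⟫| ∂(volume : Measure E).toSphere =
      (∫ φ : sphere (0 : E) 1, |⟪(φ : E), e⟫| ∂(volume : Measure E).toSphere) * ‖x‖ := by
  rw [integral_toSphere_abs_inner_eq_of_norm_eq (x := x) (y := ‖x‖ • e) (by simp [norm_smul, he]),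
    ← integral_mul_const]
  simp [inner_smul_right, abs_mul, mul_comm]

theorem abs_sub_eq_abs_posPart_sub_add (a b : ℝ) :
    |a - b| = |max a 0 - max b 0| + |max (-a) 0 - max (-b) 0| := by
  grind

/-- By antipodal symmetry, positive parts account for half of the integral. -/
theorem integral_toSphere_abs_posPart_inner_sub (s t : E) :
    ∫ φ : sphere (0 : E) 1, |max ⟪(φ : E), s⟫ 0 - max ⟪(φ : E), t⟫ 0|
        ∂(volume : Measure E).toSphere =
      1 / 2 * ∫ φ : sphere (0 : E) 1, |⟪(φ : E), s - t⟫| ∂(volume : Measure E).toSphere := by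
  have hneg := integral_toSphere_comp_isometry (LinearIsometryEquiv.neg ℝ (E := E))
    (f := fun φ => |max ⟪(φ : E), s⟫ 0 - max ⟪(φ : E), t⟫ 0|) (by fun_prop)
  simp only [LinearIsometryEquiv.coe_onUnitSphere, LinearIsometryEquiv.coe_neg,
    inner_neg_left] at hneg
  simp only [inner_sub_right, abs_sub_eq_abs_posPart_sub_add ⟪_, s⟫]
  rw [integral_add (Continuous.integrable_toSphere (by fun_prop))
    (Continuous.integrable_toSphere (by fun_prop)), hneg]
  ring

end SphereIsometry

theorem volume_symmDiff_Ioo_zero (a b : ℝ) :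
    volume (symmDiff (Ioo 0 a) (Ioo 0 b)) = ENNReal.ofReal |max a 0 - max b 0| := by
  wlog h : b ≤ a generalizing a b
  · rw [symmDiff_comm, this b a (le_of_not_ge h), abs_sub_comm]
  rw [Set.symmDiff_def, sdiff_eq_empty.2 (Ioo_subset_Ioo_right h), union_empty,
    measure_sdiff (Ioo_subset_Ioo_right h) measurableSet_Ioo.nullMeasurableSet (by simp),
    Real.volume_Ioo, Real.volume_Ioo, abs_of_nonneg (sub_nonneg.2 (max_le_max_right 0 h)),
    ENNReal.ofReal_sub _ (le_max_right b 0)]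
  simp [ENNReal.ofReal_max]

theorem measurableSet_chentsovSet (d : ℕ) (s : EuclideanSpace ℝ (Fin d)) :
    MeasurableSet (chentsovSet d s) := by
  have : IsOpen (chentsovSet d s) :=
    (isOpen_lt continuous_const continuous_snd).inter
      (isOpen_lt continuous_snd (by fun_prop))
  exact this.measurableSet

theorem restrict_Ioi_fiber_symmDiff_chentsovSet (d : ℕ) (s t : EuclideanSpace ℝ (Fin d))
    (φ : sphere (0 : EuclideanSpace ℝ (Fin d)) 1) :
    (volume.restrict (Ioi (0 : ℝ))) (Prod.mk φ ⁻¹' symmDiff (chentsovSet d s) (chentsovSet d t)) =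
      ENNReal.ofReal |max ⟪(φ : EuclideanSpace ℝ (Fin d)), s⟫ 0 -
        max ⟪(φ : EuclideanSpace ℝ (Fin d)), t⟫ 0| := by
  have hfiber : Prod.mk φ ⁻¹' symmDiff (chentsovSet d s) (chentsovSet d t) =
      symmDiff (Ioo 0 ⟪(φ : EuclideanSpace ℝ (Fin d)), s⟫)
        (Ioo 0 ⟪(φ : EuclideanSpace ℝ (Fin d)), t⟫) := rfl
  rw [hfiber, Measure.restrict_eq_self, volume_symmDiff_Ioo_zero]
  exact symmDiff_le_sup.trans (union_subset Ioo_subset_Ioi_self Ioo_subset_Ioi_self)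

/-- With `σ` the surface measure on the unit sphere `S^{d−1} ⊂ ℝ^d` and
`λ` Lebesgue measure on `(0,∞)`, the symmetric difference of `A_s` and `A_t` satisfies
`(σ ⊗ λ)(A_s Δ A_t) = (1/2)∫_{S^{d−1}} |⟨φ, s−t⟩| σ(dφ) = C‖s−t‖`, where
`C = (1/2)∫_{S^{d−1}} |⟨φ, e₁⟩| σ(dφ)` for any fixed unit vector `e₁`. -/
theorem statement6 (d : ℕ) (hd : 1 ≤ d) (s t : EuclideanSpace ℝ (Fin d))
    (e₁ : EuclideanSpace ℝ (Fin d)) (he₁ : ‖e₁‖ = 1) :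
    ((volume : Measure (EuclideanSpace ℝ (Fin d))).toSphere.prod
        (volume.restrict (Set.Ioi (0 : ℝ))))
      (symmDiff (chentsovSet d s) (chentsovSet d t))
      = ENNReal.ofReal ((1 / 2) *
          ∫ φ : Metric.sphere (0 : EuclideanSpace ℝ (Fin d)) 1,
            |⟪(φ : EuclideanSpace ℝ (Fin d)), s - t⟫|
            ∂(volume : Measure (EuclideanSpace ℝ (Fin d))).toSphere) ∧
    (1 / 2) * ∫ φ : Metric.sphere (0 : EuclideanSpace ℝ (Fin d)) 1,
        |⟪(φ : EuclideanSpace ℝ (Fin d)), s - t⟫|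
        ∂(volume : Measure (EuclideanSpace ℝ (Fin d))).toSphere
      = ((1 / 2) * ∫ φ : Metric.sphere (0 : EuclideanSpace ℝ (Fin d)) 1,
          |⟪(φ : EuclideanSpace ℝ (Fin d)), e₁⟫|
          ∂(volume : Measure (EuclideanSpace ℝ (Fin d))).toSphere) * ‖s - t‖ := by
  refine ⟨?_, ?_⟩
  · rw [Measure.prod_apply
        ((measurableSet_chentsovSet d s).symmDiff (measurableSet_chentsovSet d t)),
      ← integral_toSphere_abs_posPart_inner_sub,
      ofReal_integral_eq_lintegral_ofReal (Continuous.integrable_toSphere (by fun_prop))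
        (.of_forall fun _ => abs_nonneg _)]
    simp only [restrict_Ioi_fiber_symmDiff_chentsovSet]
  · rw [integral_toSphere_abs_inner (s - t) e₁ he₁, mul_assoc]
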